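/- Let ξ be a mixture function, let c≥0, let q₀∈(0,1), and let α:[0,1]→[0,∞) be nondecreasing with α(s)=0 for s∈[0,q₀) and ∫₀¹α(r)dr<∞. Set a(q)=∫₀^q α(r)dr and let L∈ℝ with L>∫₀¹α(r)dr. Suppose that ξ'(s)+c = ∫₀^s (L−a(q))^{-2} dq for every s∈[q₀,1]. Then c+ξ'(q₀)=q₀·ξ''(q₀), L=ξ''(q₀)^{-1/2}, L−a(s)=ξ''(s)^{-1/2} for every s∈[q₀,1], and the map s↦ξ''(s)^{-1/2} is concave on [q₀,1]. -/

import Mathlib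

open Set Filter MeasureTheory

/-- A mean-field spin glass mixture function `ξ(z) = ∑_{p≥2} c_p² z^p`:
nonnegative, exponentially decaying coefficients (indexed so that `coeff p = c_p²`),
vanishing in degrees 0 and 1, and not identically zero. -/
structure MixtureFunction where
  coeff : ℕ → ℝ
  coeff_nonneg : ∀ p, 0 ≤ coeff p
  coeff_zero : coeff 0 = 0
  coeff_one : coeff 1 = 0
  coeff_decay : ∃ C r : ℝ, 0 < C ∧ 0 < r ∧ r < 1 ∧ ∀ p, coeff p ≤ C * r ^ p
  nontrivial : ∃ p, coeff p ≠ 0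

/-- The mixture function `ξ(z) = ∑_p c_p² z^p`. -/
noncomputable def MixtureFunction.xi (ξ : MixtureFunction) (z : ℝ) : ℝ :=
  ∑' p : ℕ, ξ.coeff p * z ^ p

/-- The first derivative `ξ'(z) = ∑_p p c_p² z^(p-1)`. -/
noncomputable def MixtureFunction.xi1 (ξ : MixtureFunction) (z : ℝ) : ℝ :=
  ∑' p : ℕ, (p : ℝ) * ξ.coeff p * z ^ (p - 1)

/-- The second derivative `ξ''(z) = ∑_p p(p-1) c_p² z^(p-2)`. -/
noncomputable def MixtureFunction.xi2 (ξ : MixtureFunction) (z : ℝ) : ℝ :=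
  ∑' p : ℕ, (p : ℝ) * ((p : ℝ) - 1) * ξ.coeff p * z ^ (p - 2)

/-- The third derivative `ξ'''(z) = ∑_p p(p-1)(p-2) c_p² z^(p-3)`. -/
noncomputable def MixtureFunction.xi3 (ξ : MixtureFunction) (z : ℝ) : ℝ :=
  ∑' p : ℕ, (p : ℝ) * ((p : ℝ) - 1) * ((p : ℝ) - 2) * ξ.coeff p * z ^ (p - 3)

theorem MixtureFunction.hasDerivAt_xi1 (ξ : MixtureFunction) {s : ℝ} (hs : s ∈ Icc (0 : ℝ) 1) :
    HasDerivAt ξ.xi1 (ξ.xi2 s) s := by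
  obtain ⟨C, r, hC, hr0, hr1, hb⟩ := ξ.coeff_decay
  obtain ⟨R, hR1, hRr⟩ : ∃ R : ℝ, 1 < R ∧ r * R < 1 := by
    refine ⟨(1 + 1 / r) / 2, ?_, ?_⟩
    · have : 1 < 1 / r := by rw [lt_div_iff₀ hr0]; linarith
      linarith
    · field_simp
      linarith
  have hu : Summable (fun p : ℕ => C * ((p : ℝ) ^ 2 * (r * R) ^ p)) := by
    apply Summable.mul_left
    apply summable_pow_mul_geometric_of_norm_lt_one
    rw [Real.norm_of_nonneg (by positivity)]
    exact hRr
  have hd : ∀ (p : ℕ) (y : ℝ), y ∈ Metric.ball (0 : ℝ) R →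
      HasDerivAt (fun z : ℝ => (p : ℝ) * ξ.coeff p * z ^ (p - 1))
        ((p : ℝ) * ((p : ℝ) - 1) * ξ.coeff p * y ^ (p - 2)) y := by
    intro p y _
    have h := (hasDerivAt_pow (p - 1) y).const_mul ((p : ℝ) * ξ.coeff p)
    refine h.congr_deriv ?_
    rcases p with _ | p
    · simp
    · simp only [Nat.add_sub_cancel]
      have : p + 1 - 2 = p - 1 := by omega
      rw [this]
      push_cast
      ring
  have hbd : ∀ (p : ℕ) (y : ℝ), y ∈ Metric.ball (0 : ℝ) R →
      ‖(p : ℝ) * ((p : ℝ) - 1) * ξ.coeff p * y ^ (p - 2)‖ ≤ C * ((p : ℝ) ^ 2 * (r * R) ^ p) := by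
    intro p y hy
    have hy' : |y| ≤ R := by
      have := mem_ball_zero_iff.1 hy
      rw [Real.norm_eq_abs] at this
      exact this.le
    have h1 : |y ^ (p - 2)| ≤ R ^ p := by
      rw [abs_pow]
      calc |y| ^ (p - 2) ≤ R ^ (p - 2) := by gcongr
        _ ≤ R ^ p := pow_le_pow_right₀ hR1.le (by omega)
    have h2 : |(p : ℝ) * ((p : ℝ) - 1)| ≤ (p : ℝ) ^ 2 := by
      rcases p with _ | p
      · simp
      · push_cast
        rw [abs_of_nonneg (by simp; positivity)]
        nlinarith [(Nat.cast_nonneg p : (0 : ℝ) ≤ p)]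
    have h3 : |ξ.coeff p| ≤ C * r ^ p := by
      rw [abs_of_nonneg (ξ.coeff_nonneg p)]
      exact hb p
    rw [Real.norm_eq_abs, abs_mul, abs_mul]
    calc _ ≤ (p : ℝ) ^ 2 * (C * r ^ p) * R ^ p := by gcongr
      _ = _ := by rw [mul_pow]; ring
  have h0 : Summable (fun p : ℕ => (p : ℝ) * ξ.coeff p * (0 : ℝ) ^ (p - 1)) := by
    apply summable_of_ne_finset_zero (s := Finset.range 2)
    intro p hp
    have : p - 1 ≠ 0 := by simp at hp; omega
    simp [this]
  exact hasDerivAt_tsum_of_isPreconnected hu Metric.isOpen_ball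
    (convex_ball (0 : ℝ) R).isPreconnected hd hbd (Metric.mem_ball_self (by linarith)) h0
    (by rw [mem_ball_zero_iff, Real.norm_of_nonneg hs.1]; linarith [hs.2])

/-- No overlap-gap forces concavity of `ξ''^{-1/2}`: if `α` is nondecreasing, vanishes on
`[0,q₀)`, and the zero-temperature stationarity condition
`ξ'(s) + c = ∫₀^s (L - a(q))⁻² dq` holds on `[q₀,1]`, then `c + ξ'(q₀) = q₀ ξ''(q₀)`,
`L = ξ''(q₀)^{-1/2}`, `L - a(s) = ξ''(s)^{-1/2}` on `[q₀,1]`, and `s ↦ ξ''(s)^{-1/2}` is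
concave on `[q₀,1]`. -/
theorem stationarity_implies_concavity (ξ : MixtureFunction) (c : ℝ) (hc : 0 ≤ c)
    (q₀ : ℝ) (hq₀ : q₀ ∈ Ioo (0 : ℝ) 1)
    (α : ℝ → ℝ) (hα0 : ∀ r ∈ Icc (0 : ℝ) 1, 0 ≤ α r)
    (hαmono : MonotoneOn α (Icc 0 1))
    (hαzero : ∀ s ∈ Ico (0 : ℝ) q₀, α s = 0)
    (hαint : IntervalIntegrable α volume 0 1)
    (L : ℝ) (hL : (∫ r in (0 : ℝ)..1, α r) < L)
    (hstat : ∀ s ∈ Icc q₀ 1,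
      ξ.xi1 s + c = ∫ q in (0 : ℝ)..s, ((L - ∫ r in (0 : ℝ)..q, α r)⁻¹) ^ 2) :
    c + ξ.xi1 q₀ = q₀ * ξ.xi2 q₀ ∧
      L = (Real.sqrt (ξ.xi2 q₀))⁻¹ ∧
      (∀ s ∈ Icc q₀ 1, L - (∫ r in (0 : ℝ)..s, α r) = (Real.sqrt (ξ.xi2 s))⁻¹) ∧
      ConcaveOn ℝ (Icc q₀ 1) (fun s => (Real.sqrt (ξ.xi2 s))⁻¹) := by
  obtain ⟨hq0, hq1⟩ := hq₀
  have hsub : ∀ x ∈ Icc (0 : ℝ) 1, ∀ y ∈ Icc (0 : ℝ) 1, IntervalIntegrable α volume x y := by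
    intro x hx y hy
    apply hαint.mono_set
    rw [uIcc_of_le zero_le_one]
    exact uIcc_subset_Icc hx hy
  have h0m : (0 : ℝ) ∈ Icc (0 : ℝ) 1 := by simp
  have h1m : (1 : ℝ) ∈ Icc (0 : ℝ) 1 := by simp
  set a : ℝ → ℝ := fun q => ∫ r in (0 : ℝ)..q, α r with ha
  have hdiff : ∀ x ∈ Icc (0 : ℝ) 1, ∀ y ∈ Icc (0 : ℝ) 1, a y - a x = ∫ r in x..y, α r := by
    intro x hx y hy
    exact intervalIntegral.integral_interval_sub_left (hsub 0 h0m y hy) (hsub 0 h0m x hx)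
  have hlow : ∀ x ∈ Icc (0 : ℝ) 1, ∀ y ∈ Icc (0 : ℝ) 1, x ≤ y → (y - x) * α x ≤ a y - a x := by
    intro x hx y hy hxy
    rw [hdiff x hx y hy]
    have := intervalIntegral.integral_mono_on hxy (intervalIntegrable_const (c := α x))
      (hsub x hx y hy) (fun t ht => hαmono hx ⟨hx.1.trans ht.1, ht.2.trans hy.2⟩ ht.1)
    simpa using this
  have hupp : ∀ x ∈ Icc (0 : ℝ) 1, ∀ y ∈ Icc (0 : ℝ) 1, x ≤ y → a y - a x ≤ (y - x) * α y := by
    intro x hx y hy hxy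
    rw [hdiff x hx y hy]
    have := intervalIntegral.integral_mono_on hxy (hsub x hx y hy)
      (intervalIntegrable_const (c := α y))
      (fun t ht => hαmono ⟨hx.1.trans ht.1, ht.2.trans hy.2⟩ hy ht.2)
    simpa using this
  have hpos : ∀ x ∈ Icc (0 : ℝ) 1, 0 < L - a x := by
    intro x hx
    have h1 := hlow x hx 1 h1m hx.2
    have h2 := mul_nonneg (sub_nonneg.2 hx.2) (hα0 x hx)
    have h3 : a 1 < L := hL
    linarith
  have hacont : ContinuousOn a (Icc 0 1) := by
    have := intervalIntegral.continuousOn_primitive_interval'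
      (μ := volume) (f := α) (a := 0) (b₁ := 0) (b₂ := 1) hαint (by simp)
    rwa [uIcc_of_le zero_le_one] at this
  have hgcont : ContinuousOn (fun q => ((L - a q)⁻¹) ^ 2) (Icc 0 1) :=
    ((continuousOn_const.sub hacont).inv₀ (fun x hx => (hpos x hx).ne')).pow 2
  set g : ℝ → ℝ := IccExtend (zero_le_one' ℝ) ((Icc (0:ℝ) 1).restrict (fun q => ((L - a q)⁻¹) ^ 2))
    with hg
  have hgc : Continuous g := (continuousOn_iff_continuous_restrict.1 hgcont).Icc_extend'
  have hgeq : ∀ q ∈ Icc (0 : ℝ) 1, g q = ((L - a q)⁻¹) ^ 2 := by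
    intro q hq
    rw [hg, IccExtend_of_mem _ _ hq]
    rfl
  have hstat' : ∀ s ∈ Icc q₀ 1, ξ.xi1 s + c = ∫ q in (0 : ℝ)..s, g q := by
    intro s hs
    rw [hstat s hs]
    apply intervalIntegral.integral_congr
    intro q hq
    rw [uIcc_of_le (hq0.le.trans hs.1)] at hq
    exact (hgeq q ⟨hq.1, hq.2.trans hs.2⟩).symm
  have hmem : ∀ s ∈ Icc q₀ 1, s ∈ Icc (0 : ℝ) 1 := fun s hs => ⟨hq0.le.trans hs.1, hs.2⟩
  have hxi2 : ∀ s ∈ Icc q₀ 1, ξ.xi2 s = ((L - a s)⁻¹) ^ 2 := by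
    intro s hs
    have hA : HasDerivWithinAt (fun s => ξ.xi1 s + c) (ξ.xi2 s) (Icc q₀ 1) s :=
      ((ξ.hasDerivAt_xi1 (hmem s hs)).add_const c).hasDerivWithinAt
    have hB : HasDerivWithinAt (fun s => ξ.xi1 s + c) (g s) (Icc q₀ 1) s :=
      (hgc.integral_hasStrictDerivAt 0 s).hasDerivAt.hasDerivWithinAt.congr hstat' (hstat' s hs)
    rw [← hgeq s (hmem s hs)]
    exact ((uniqueDiffOn_Icc hq1) s hs).eq_deriv _ hA hB
  have hmain : ∀ s ∈ Icc q₀ 1, L - a s = (Real.sqrt (ξ.xi2 s))⁻¹ := by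
    intro s hs
    rw [hxi2 s hs, Real.sqrt_sq (inv_nonneg.2 (hpos s (hmem s hs)).le), inv_inv]
  have hqm : q₀ ∈ Icc q₀ 1 := ⟨le_rfl, hq1.le⟩
  have hazero : ∀ q ∈ Icc 0 q₀, a q = 0 := by
    intro q hq
    have : a q = ∫ r in (0 : ℝ)..q, (0 : ℝ) := by
      apply intervalIntegral.integral_congr_ae
      have hne : ∀ᵐ x : ℝ, x ≠ q₀ := by simp [ae_iff, measure_singleton]
      filter_upwards [hne] with x hx hx2
      rw [uIoc_of_le hq.1] at hx2
      exact hαzero x ⟨hx2.1.le, lt_of_le_of_ne (hx2.2.trans hq.2) hx⟩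
    simpa using this
  have haq := hazero q₀ ⟨hq0.le, le_rfl⟩
  refine ⟨?_, ?_, hmain, ?_⟩
  · rw [add_comm, hstat q₀ hqm, hxi2 q₀ hqm, haq]
    have : ∫ q in (0 : ℝ)..q₀, ((L - a q)⁻¹) ^ 2 = ∫ q in (0 : ℝ)..q₀, ((L - 0)⁻¹) ^ 2 := by
      apply intervalIntegral.integral_congr
      intro q hq
      rw [uIcc_of_le hq0.le] at hq
      simp only [hazero q hq]
    exact this.trans (by simp)
  · rw [← hmain q₀ hqm, haq, sub_zero]
  · have hconv : ConvexOn ℝ (Icc q₀ 1) a := by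
      apply convexOn_of_slope_mono_adjacent (convex_Icc q₀ 1)
      intro x y z hx hz hxy hyz
      have hy : y ∈ Icc q₀ 1 := ⟨hx.1.trans hxy.le, hyz.le.trans hz.2⟩
      have h1 := hupp x (hmem x hx) y (hmem y hy) hxy.le
      have h2 := hlow y (hmem y hy) z (hmem z hz) hyz.le
      calc (a y - a x) / (y - x) ≤ α y := by
            rw [div_le_iff₀ (sub_pos.2 hxy)]; linarith
        _ ≤ (a z - a y) / (z - y) := by
            rw [le_div_iff₀ (sub_pos.2 hyz)]; linarith
    have hcc : ConcaveOn ℝ (Icc q₀ 1) (fun s => L - a s) :=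
      (concaveOn_const L (convex_Icc q₀ 1)).sub hconv
    exact hcc.congr hmain
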